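/- First-order asymptotics at the pole: let κ > 0 and let F be twice differentiable on (0,π) and solve the hedgehog Skyrme ODE on (0,π), with F(ψ) → 0 as ψ → 0⁺ and with F(ψ) > 0 and F'(ψ) > 0 on some interval (0, ε). Then the limit a = lim_{ψ→0⁺} F(ψ)/ψ exists and is finite, and F(ψ) = a·ψ + O(ψ³) as ψ → 0⁺; that is, there exist constants C > 0 and δ > 0 such that |F(ψ) − a·ψ| ≤ C·ψ³ for all ψ ∈ (0, δ). -/

import Mathlib

open Real Set Filter Topology

/-- The hedgehog Skyrme ODE on the three-sphere with coupling constant `κ`: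
`(sin²ψ + κ²·sin²F)·F'' + sin(2ψ)·F' + (κ²/2)·sin(2F)·F'² − sin(2F)
  − (κ²/2)·(sin²F/sin²ψ)·sin(2F) = 0` on `(0, π)`. -/
def SkyrmeEq (κ : ℝ) (F : ℝ → ℝ) : Prop :=
  ∀ ψ ∈ Set.Ioo (0:ℝ) Real.pi,
    (Real.sin ψ ^ 2 + κ ^ 2 * Real.sin (F ψ) ^ 2) * deriv (deriv F) ψ
      + Real.sin (2 * ψ) * deriv F ψ
      + κ ^ 2 / 2 * Real.sin (2 * F ψ) * deriv F ψ ^ 2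
      - Real.sin (2 * F ψ)
      - κ ^ 2 / 2 * (Real.sin (F ψ) ^ 2 / Real.sin ψ ^ 2) * Real.sin (2 * F ψ) = 0

/-- `F` is twice differentiable on `(0, π)`. -/
def TwiceDiffOnIoo (F : ℝ → ℝ) : Prop :=
  ∀ ψ ∈ Set.Ioo (0:ℝ) Real.pi,
    DifferentiableAt ℝ F ψ ∧ DifferentiableAt ℝ (deriv F) ψ

/-- A positive function `V` on `(0, x₀]` with `x V' > η` wherever `V < 1 - 4 η` satisfies
`V x₀ ≥ 1 - 4 η`: otherwise it would reach `0` between `0` and `x₀`. -/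
lemma one_sub_le_of_deriv_lower_bound {V V' : ℝ → ℝ} {x₀ η : ℝ} (hx₀ : 0 < x₀) (hη : 0 < η)
    (hV : ∀ x ∈ Ioc 0 x₀, HasDerivAt V (V' x) x) (hpos : ∀ x ∈ Ioc 0 x₀, 0 < V x)
    (hlow : ∀ x ∈ Ioc 0 x₀, V x < 1 - 4 * η → η < x * V' x) :
    1 - 4 * η ≤ V x₀ := by
  by_contra! hlt
  have hmem : ∀ t : ℝ, 0 ≤ t → x₀ * exp (-t) ∈ Ioc 0 x₀ := fun t ht =>
    ⟨by positivity, mul_le_of_le_one_right hx₀.le (exp_le_one_iff.2 (by linarith))⟩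
  have hder : ∀ t : ℝ, 0 ≤ t → HasDerivAt (fun t => V (x₀ * exp (-t)))
      (V' (x₀ * exp (-t)) * (x₀ * (exp (-t) * -1))) t := fun t ht =>
    (hV _ (hmem t ht)).comp t (((hasDerivAt_neg t).exp).const_mul x₀)
  have hB : ∀ t : ℝ, HasDerivAt (fun t => V x₀ - η * t) (-η) t := fun t => by
    simpa using ((hasDerivAt_id t).const_mul η).const_sub (V x₀)
  have hVx₀ : 0 < V x₀ := hpos _ ⟨hx₀, le_rfl⟩
  have hT : 0 ≤ V x₀ / η := by positivity
  have key := image_le_of_deriv_right_lt_deriv_boundary' (a := 0) (b := V x₀ / η)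
    (f := fun t => V (x₀ * exp (-t))) (B := fun t => V x₀ - η * t) (B' := fun _ => -η)
    (fun t ht => (hder t ht.1).continuousAt.continuousWithinAt)
    (fun t ht => (hder t ht.1).hasDerivWithinAt) (by simp)
    (fun t _ => (hB t).continuousAt.continuousWithinAt)
    (fun t _ => (hB t).hasDerivWithinAt)
    (fun t ht heq => by
      have hm := hmem t ht.1
      have hηt : 0 ≤ η * t := mul_nonneg hη.le ht.1
      have h := hlow _ hm (by linarith)
      linarith)
    (right_mem_Icc.2 hT)
  have h0 : V x₀ - η * (V x₀ / η) = 0 := by field_simp; ring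
  simp only [h0] at key
  exact absurd (hpos _ (hmem _ hT)) (not_lt.2 key)

/-- A positive function on `(0, δ)` with `|u'| ≤ 2Kx` has a limit at `0⁺`, with rate `K x ^ 2`. -/
lemma exists_abs_sub_le_of_abs_deriv_le {u u' : ℝ → ℝ} {δ K : ℝ} (hδ : 0 < δ) (hK : 0 ≤ K)
    (hu : ∀ x ∈ Ioo 0 δ, HasDerivAt u (u' x) x) (hpos : ∀ x ∈ Ioo 0 δ, 0 < u x)
    (hbd : ∀ x ∈ Ioo 0 δ, |u' x| ≤ 2 * K * x) :
    ∃ a, ∀ x ∈ Ioo 0 δ, |u x - a| ≤ K * x ^ 2 := by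
  have hsq : ∀ x : ℝ, HasDerivAt (fun x => K * x ^ 2) (2 * K * x) x := fun x => by
    refine ((hasDerivAt_pow 2 x).const_mul K).congr_deriv ?_
    norm_num
    ring
  have hmono : MonotoneOn (fun x => u x + K * x ^ 2) (Ioo 0 δ) := by
    refine monotoneOn_of_hasDerivWithinAt_nonneg (convex_Ioo 0 δ)
      (fun x hx => ((hu x hx).add (hsq x)).continuousAt.continuousWithinAt)
      (fun x hx => ((hu x (interior_subset hx)).add (hsq x)).hasDerivWithinAt) fun x hx => ?_
    linarith [(abs_le.1 (hbd x (interior_subset hx))).1]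
  have hanti : AntitoneOn (fun x => u x - K * x ^ 2) (Ioo 0 δ) := by
    refine antitoneOn_of_hasDerivWithinAt_nonpos (convex_Ioo 0 δ)
      (fun x hx => ((hu x hx).sub (hsq x)).continuousAt.continuousWithinAt)
      (fun x hx => ((hu x (interior_subset hx)).sub (hsq x)).hasDerivWithinAt) fun x hx => ?_
    linarith [(abs_le.1 (hbd x (interior_subset hx))).2]
  set S := (fun x => u x + K * x ^ 2) '' Ioo 0 δ with hS
  have hSb : BddBelow S := by
    refine ⟨0, ?_⟩
    rintro _ ⟨x, hx, rfl⟩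
    have := hpos x hx
    positivity
  have hSn : S.Nonempty := ⟨_, δ / 2, ⟨by linarith, by linarith⟩, rfl⟩
  refine ⟨sInf S, fun x hx => abs_le.2 ⟨?_, ?_⟩⟩
  · linarith [csInf_le hSb (mem_image_of_mem (fun x => u x + K * x ^ 2) hx)]
  · suffices u x - K * x ^ 2 ≤ sInf S by linarith
    refine le_csInf hSn ?_
    rintro _ ⟨y, hy, rfl⟩
    have hx2 : 0 ≤ K * x ^ 2 := by positivity
    have hy2 : 0 ≤ K * y ^ 2 := by positivity
    rcases le_total y x with h | h
    · have := hanti hy hx h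
      simp only at this ⊢
      linarith
    · have := hmono hx hy h
      simp only at this ⊢
      linarith

/-- If the logarithmic slope `x F' / F` differs from `1` by `O(x ^ 2 + F ^ 2)` (with a small
right-hand side), then `F x / x = a + O(x ^ 2)`. -/
lemma exists_abs_div_sub_le_of_log_slope {F F' : ℝ → ℝ} {δ K : ℝ} (hδ : 0 < δ) (hδ1 : δ ≤ 1)
    (hK : 0 < K) (hF : ∀ x ∈ Ioo 0 δ, HasDerivAt F (F' x) x) (hpos : ∀ x ∈ Ioo 0 δ, 0 < F x)
    (hsmall : ∀ x ∈ Ioo 0 δ, K * (x ^ 2 + F x ^ 2) ≤ 1 / 2)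
    (hslope : ∀ x ∈ Ioo 0 δ, |x * F' x - F x| ≤ K * (x ^ 2 + F x ^ 2) * F x) :
    ∃ a, ∃ C > 0, ∃ δ' > 0, ∀ x ∈ Ioo 0 δ', |F x / x - a| ≤ C * x ^ 2 := by
  have hu : ∀ x ∈ Ioo 0 δ, HasDerivAt (fun x => F x / x) ((F' x * x - F x) / x ^ 2) x :=
    fun x hx => by simpa using (hF x hx).fun_div (hasDerivAt_id' x) hx.1.ne'
  have hm1 : MonotoneOn (fun x => F x ^ 2 / x) (Ioo 0 δ) := by
    have hd : ∀ x ∈ Ioo 0 δ, HasDerivAt (fun x => F x ^ 2 / x)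
        ((2 * F x * F' x * x - F x ^ 2) / x ^ 2) x := fun x hx => by
      simpa using ((hF x hx).fun_pow 2).fun_div (hasDerivAt_id' x) hx.1.ne'
    refine monotoneOn_of_hasDerivWithinAt_nonneg (convex_Ioo 0 δ)
      (fun x hx => (hd x hx).continuousAt.continuousWithinAt)
      (fun x hx => (hd x (interior_subset hx)).hasDerivWithinAt) fun x hx => ?_
    have hx := interior_subset hx
    have h := (abs_le.1 (hslope x hx)).1
    have hp := hpos x hx
    have hs := mul_le_mul_of_nonneg_right (hsmall x hx) hp.le
    refine div_nonneg ?_ (sq_nonneg x)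
    nlinarith
  set y := δ / 2 with hy
  have hyδ : y ∈ Ioo 0 δ := ⟨by linarith, by linarith⟩
  have hypos : 0 < y := hyδ.1
  have hFy := hpos y hyδ
  have hsub : ∀ x ∈ Ioo 0 y, x ∈ Ioo 0 δ := fun x hx => ⟨hx.1, hx.2.trans hyδ.2⟩
  set M := F y ^ 2 / y with hM
  have hM0 : 0 < M := by positivity
  have hFM : ∀ x ∈ Ioo 0 y, F x ^ 2 ≤ M * x := fun x hx =>
    (div_le_iff₀ hx.1).1 (hm1 (hsub x hx) hyδ hx.2.le)
  -- `F ^ 2 = O(x)` makes `F / x` times an exponential monotone, so `F / x` is bounded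
  set L := K * (1 + M) with hL
  have hL0 : 0 < L := by positivity
  have hm2 : MonotoneOn (fun x => F x / x * exp (L * x)) (Ioo 0 y) := by
    have hd : ∀ x ∈ Ioo 0 y, HasDerivAt (fun x => F x / x * exp (L * x))
        ((F' x * x - F x) / x ^ 2 * exp (L * x) + F x / x * (exp (L * x) * L)) x :=
      fun x hx => (hu x (hsub x hx)).mul (by simpa using ((hasDerivAt_id x).const_mul L).exp)
    refine monotoneOn_of_hasDerivWithinAt_nonneg (convex_Ioo 0 y)
      (fun x hx => (hd x hx).continuousAt.continuousWithinAt)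
      (fun x hx => (hd x (interior_subset hx)).hasDerivWithinAt) fun x hx => ?_
    have hx := interior_subset hx
    have hx0 : 0 < x := hx.1
    have hp := hpos x (hsub x hx)
    have h := (abs_le.1 (hslope x (hsub x hx))).1
    have hx1 : x ^ 2 ≤ x := by nlinarith [(hsub x hx).2]
    have hle : K * (x ^ 2 + F x ^ 2) ≤ L * x := by
      rw [hL]; nlinarith [hFM x hx]
    have h2 := mul_le_mul_of_nonneg_right hle hp.le
    have heq : (F' x * x - F x) / x ^ 2 * exp (L * x) + F x / x * (exp (L * x) * L)
        = exp (L * x) / x ^ 2 * (F' x * x - F x + L * x * F x) := by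
      field_simp
    rw [heq]
    exact mul_nonneg (by positivity) (by linarith)
  set z := y / 2 with hz
  have hzy : z ∈ Ioo 0 y := ⟨by linarith, by linarith⟩
  have hzpos : 0 < z := hzy.1
  have hFz := hpos z (hsub z hzy)
  set N := F z / z * exp (L * z) with hN
  have hN0 : 0 < N := by positivity
  have hsub' : ∀ x ∈ Ioo 0 z, x ∈ Ioo 0 y := fun x hx => ⟨hx.1, hx.2.trans hzy.2⟩
  have huN : ∀ x ∈ Ioo 0 z, F x / x ≤ N := fun x hx => by
    have hx0 : 0 < x := hx.1
    have hp := hpos x (hsub x (hsub' x hx))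
    have h := hm2 (hsub' x hx) hzy hx.2.le
    have h1 : 1 ≤ exp (L * x) := one_le_exp (by positivity)
    exact (le_mul_of_one_le_right (by positivity) h1).trans h
  obtain ⟨a, ha⟩ := exists_abs_sub_le_of_abs_deriv_le (u := fun x => F x / x)
    (u' := fun x => (F' x * x - F x) / x ^ 2) (K := K * (1 + N ^ 2) * N) hzpos (by positivity)
    (fun x hx => hu x (hsub x (hsub' x hx)))
    (fun x hx => div_pos (hpos x (hsub x (hsub' x hx))) hx.1)
    (fun x hx => by
      have hx0 : 0 < x := hx.1
      have hxδ := hsub x (hsub' x hx)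
      have hp := hpos x hxδ
      have hFN : F x ≤ N * x := (div_le_iff₀ hx0).1 (huN x hx)
      have hF2 : F x ^ 2 ≤ (N * x) ^ 2 := pow_le_pow_left₀ hp.le hFN 2
      have h := hslope x hxδ
      rw [abs_div, abs_of_pos (pow_pos hx0 2), div_le_iff₀ (pow_pos hx0 2), mul_comm (F' x)]
      calc |x * F' x - F x| ≤ K * (x ^ 2 + F x ^ 2) * F x := h
        _ ≤ K * (x ^ 2 + (N * x) ^ 2) * (N * x) := by gcongr
        _ = K * (1 + N ^ 2) * N * x ^ 3 := by ring
        _ ≤ 2 * (K * (1 + N ^ 2) * N * x ^ 3) := by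
          have : 0 ≤ K * (1 + N ^ 2) * N * x ^ 3 := by positivity
          linarith
        _ = 2 * (K * (1 + N ^ 2) * N) * x * x ^ 2 := by ring)
  exact ⟨a, _, by positivity, z, hzpos, ha⟩

lemma abs_cos_sub_cos_le_half_sq_add_sq (x y : ℝ) : |cos x - cos y| ≤ (x ^ 2 + y ^ 2) / 2 := by
  rw [abs_le]
  constructor <;>
    linarith [one_sub_sq_div_two_le_cos (x := x), one_sub_sq_div_two_le_cos (x := y), cos_le_one x,
      cos_le_one y, sq_nonneg x, sq_nonneg y]

/-- The Skyrme equation, as a Riccati identity for `v = s p / S`, where `s, c, S, C` stand for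
`sin ψ, cos ψ, sin F, cos F` and `p, r` for `F', F''`. -/
lemma skyrme_riccati {k s c S C p r : ℝ} (hs : s ≠ 0) (hS : S ≠ 0)
    (h : (s ^ 2 + k ^ 2 * S ^ 2) * r + 2 * s * c * p + k ^ 2 / 2 * (2 * S * C) * p ^ 2
      - 2 * S * C - k ^ 2 / 2 * (S ^ 2 / s ^ 2) * (2 * S * C) = 0) :
    (s ^ 2 + k ^ 2 * S ^ 2) * (s * (((c * p + s * r) * S - s * p * (C * p)) / S ^ 2)) =
      C * (1 - s * p / S) * ((s ^ 2 + 2 * (k ^ 2 * S ^ 2)) * (s * p / S) + 2 * s ^ 2 + k ^ 2 * S ^ 2)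
        + (C - c) * (s ^ 2 - k ^ 2 * S ^ 2) * (s * p / S) := by
  field_simp at h ⊢
  linear_combination S * h

/-- Lower bound for the right-hand side of the Riccati identity below level `1`. -/
lemma riccati_lower_bound {A B C e η D w : ℝ} {α β : ℝ} (hA : 0 < A) (hB : 0 ≤ B)
    (hC : 1 / 2 ≤ C) (he : |e| ≤ η) (hw : 0 < w) (hw1 : w < 1) (hα : 0 ≤ α) (hβ : A + B ≤ β)
    (h : (A + B) * D = C * (1 - w) * (α * w + β) + e * (A - B) * w) :
    (1 - w) / 2 - η * w ≤ D := by
  have hAB : 0 < A + B := by linarith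
  have h1 : (A + B) * ((1 - w) / 2) ≤ C * (1 - w) * (α * w + β) := by
    have h2 : A + B ≤ α * w + β := by nlinarith [mul_nonneg hα hw.le]
    have h3 : (1 - w) / 2 ≤ C * (1 - w) := by nlinarith
    calc (A + B) * ((1 - w) / 2) = (1 - w) / 2 * (A + B) := by ring
      _ ≤ C * (1 - w) * (α * w + β) := by
        apply mul_le_mul h3 h2 hAB.le
        nlinarith
  have h4 : -((A + B) * (η * w)) ≤ e * (A - B) * w := by
    have h5 : |e * (A - B)| ≤ η * (A + B) := by
      rw [abs_mul]
      exact mul_le_mul he (abs_le.2 ⟨by linarith, by linarith⟩) (abs_nonneg _)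
        ((abs_nonneg e).trans he)
    nlinarith [(abs_le.1 h5).1]
  refine le_of_mul_le_mul_left ?_ hAB
  linarith

/-- The pointwise comparison of `ψ F'` with `F`, from the one of `sin ψ F'` with `sin F`. -/
lemma abs_mul_sub_le_of_abs_sin {x f p η : ℝ} (hx : 0 < x) (hx1 : x ≤ 1 / 10) (hf : 0 < f)
    (hf1 : f ≤ 1 / 10) (hη : η = (x ^ 2 + f ^ 2) / 2)
    (hlo : 1 - 4 * η ≤ sin x * p / sin f) (hhi : 1 - 4 * η ≤ sin f / (sin x * p)) (hp : 0 < p) :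
    |x * p - f| ≤ 20 * (x ^ 2 + f ^ 2) * f := by
  have hsx : sin x < x := sin_lt hx
  have hsx' : x - x ^ 3 / 6 < sin x := sin_gt_sub_cube hx
  have hsf : sin f < f := sin_lt hf
  have hsf' : f - f ^ 3 / 6 < sin f := sin_gt_sub_cube hf
  have hx2 : x ^ 2 ≤ 1 / 100 := by nlinarith
  have hf2 : f ^ 2 ≤ 1 / 100 := by nlinarith
  have hsx0 : 0 < sin x := by nlinarith
  have hsf0 : 0 < sin f := by nlinarith
  rw [le_div_iff₀ hsf0] at hlo
  rw [le_div_iff₀ (by positivity)] at hhi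
  have hη0 : 0 < η := by rw [hη]; positivity
  have hη1 : η ≤ 1 / 100 := by linarith
  have hxp : 0 < x * p := by positivity
  have hx2η : x ^ 2 ≤ 2 * η := by rw [hη]; nlinarith
  have hf2η : f ^ 2 ≤ 2 * η := by rw [hη]; nlinarith
  -- lower bound
  have h1 : (1 - 4 * η) * (f * (1 - η)) ≤ x * p := by
    have ha : f * (1 - η) ≤ sin f := by nlinarith
    have hb : sin x * p ≤ x * p := by gcongr
    have hc : (1 - 4 * η) * (f * (1 - η)) ≤ (1 - 4 * η) * sin f :=
      mul_le_mul_of_nonneg_left ha (by linarith)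
    linarith
  -- upper bound
  have h2 : (1 - 4 * η) * ((1 - η) * (x * p)) ≤ f := by
    have ha : x * (1 - η) ≤ sin x := by nlinarith
    have hb : (1 - η) * (x * p) ≤ sin x * p := by nlinarith
    have hc := mul_le_mul_of_nonneg_left hb (by linarith : (0:ℝ) ≤ 1 - 4 * η)
    linarith
  have h3 : 1 - 5 * η ≤ (1 - 4 * η) * (1 - η) := by nlinarith
  have h4 : (1 - 5 * η) * (x * p) ≤ f := by nlinarith
  have h5 : x * p ≤ 2 * f := by nlinarith
  have h6 : 20 * (x ^ 2 + f ^ 2) * f = 40 * (η * f) := by rw [hη]; ring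
  have h7 : η * (x * p) ≤ η * (2 * f) := by gcongr
  have h8 : 0 < η * f := by positivity
  rw [h6, abs_le]
  constructor <;> nlinarith

/-- First-order asymptotics at the pole: for a solution `F` of the hedgehog
Skyrme ODE with `F → 0` at `0⁺`, positive with positive derivative near `0`,
the limit `a = lim_{ψ→0⁺} F(ψ)/ψ` exists and `F(ψ) = a·ψ + O(ψ³)` as `ψ → 0⁺`. -/
theorem skyrme_first_order_asymptotics (κ : ℝ) (hκ : 0 < κ) (F : ℝ → ℝ)
    (hF : TwiceDiffOnIoo F) (hode : SkyrmeEq κ F)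
    (hlim : Filter.Tendsto F (nhdsWithin 0 (Set.Ioi 0)) (nhds 0))
    (ε : ℝ) (hε : 0 < ε)
    (hpos : ∀ ψ ∈ Set.Ioo (0:ℝ) ε, 0 < F ψ ∧ 0 < deriv F ψ) :
    ∃ a : ℝ,
      Filter.Tendsto (fun ψ => F ψ / ψ) (nhdsWithin 0 (Set.Ioi 0)) (nhds a) ∧
      ∃ C > 0, ∃ δ > 0, ∀ ψ ∈ Set.Ioo (0:ℝ) δ, |F ψ - a * ψ| ≤ C * ψ ^ 3 := by
  obtain ⟨δ₁, hδ₁, hFδ₁⟩ := mem_nhdsGT_iff_exists_Ioo_subset.1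
    (hlim.eventually_lt_const (show (0:ℝ) < 1 / 10 by norm_num))
  have hδ₁ : 0 < δ₁ := hδ₁
  obtain ⟨δ, hδ0, hδε, hδδ₁, hδ10⟩ : ∃ δ > 0, δ ≤ ε ∧ δ ≤ δ₁ ∧ δ ≤ 1 / 10 :=
    ⟨min ε (min δ₁ (1 / 10)), by positivity, min_le_left _ _,
      (min_le_right _ _).trans (min_le_left _ _), (min_le_right _ _).trans (min_le_right _ _)⟩
  have hFsmall : ∀ x ∈ Ioo 0 δ, F x < 1 / 10 := fun x hx =>
    hFδ₁ ⟨hx.1, hx.2.trans_le hδδ₁⟩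
  have hF0 : ∀ x ∈ Ioo 0 δ, 0 < F x := fun x hx => (hpos x ⟨hx.1, hx.2.trans_le hδε⟩).1
  have hp0 : ∀ x ∈ Ioo 0 δ, 0 < deriv F x := fun x hx => (hpos x ⟨hx.1, hx.2.trans_le hδε⟩).2
  have hπ : ∀ x ∈ Ioo 0 δ, x ∈ Ioo 0 π := fun x hx => ⟨hx.1, by linarith [hx.2, pi_gt_three]⟩
  have hFd : ∀ x ∈ Ioo 0 δ, HasDerivAt F (deriv F x) x := fun x hx => (hF x (hπ x hx)).1.hasDerivAt
  have hFdd : ∀ x ∈ Ioo 0 δ, HasDerivAt (deriv F) (deriv (deriv F) x) x :=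
    fun x hx => (hF x (hπ x hx)).2.hasDerivAt
  have hs0 : ∀ x ∈ Ioo 0 δ, 0 < sin x := fun x hx => sin_pos_of_mem_Ioo (hπ x hx)
  have hS0 : ∀ x ∈ Ioo 0 δ, 0 < sin (F x) := fun x hx =>
    sin_pos_of_pos_of_lt_pi (hF0 x hx) (by linarith [hFsmall x hx, pi_gt_three])
  have hC : ∀ x ∈ Ioo 0 δ, 1 / 2 ≤ cos (F x) := fun x hx => by
    have := one_sub_sq_div_two_le_cos (x := F x)
    nlinarith [hFsmall x hx, hF0 x hx]
  have hFmono : MonotoneOn F (Ioo 0 δ) :=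
    monotoneOn_of_hasDerivWithinAt_nonneg (convex_Ioo 0 δ)
      (fun x hx => (hFd x hx).continuousAt.continuousWithinAt)
      (fun x hx => (hFd x (interior_subset hx)).hasDerivWithinAt)
      fun x hx => (hp0 x (interior_subset hx)).le
  set v' : ℝ → ℝ := fun x => ((cos x * deriv F x + sin x * deriv (deriv F) x) * sin (F x)
    - sin x * deriv F x * (cos (F x) * deriv F x)) / sin (F x) ^ 2 with hv'
  have hv : ∀ x ∈ Ioo 0 δ, HasDerivAt (fun x => sin x * deriv F x / sin (F x)) (v' x) x :=
    fun x hx => (((hasDerivAt_sin x).mul (hFdd x hx)).div (hFd x hx).sin (hS0 x hx).ne')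
  have hv0 : ∀ x ∈ Ioo 0 δ, 0 < sin x * deriv F x / sin (F x) := fun x hx =>
    div_pos (mul_pos (hs0 x hx) (hp0 x hx)) (hS0 x hx)
  have hric : ∀ x ∈ Ioo 0 δ, (sin x ^ 2 + κ ^ 2 * sin (F x) ^ 2) * (sin x * v' x) =
      cos (F x) * (1 - sin x * deriv F x / sin (F x)) *
        ((sin x ^ 2 + 2 * (κ ^ 2 * sin (F x) ^ 2)) * (sin x * deriv F x / sin (F x))
          + 2 * sin x ^ 2 + κ ^ 2 * sin (F x) ^ 2)
        + (cos (F x) - cos x) * (sin x ^ 2 - κ ^ 2 * sin (F x) ^ 2)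
          * (sin x * deriv F x / sin (F x)) := fun x hx => by
    refine skyrme_riccati (hs0 x hx).ne' (hS0 x hx).ne' ?_
    have h := hode x (hπ x hx)
    rw [sin_two_mul, sin_two_mul] at h
    exact h
  have hslope : ∀ x ∈ Ioo 0 δ, |x * deriv F x - F x| ≤ 20 * (x ^ 2 + F x ^ 2) * F x := by
    intro x₀ hx₀
    have hsub : ∀ x ∈ Ioc 0 x₀, x ∈ Ioo 0 δ := fun x hx => ⟨hx.1, hx.2.trans_lt hx₀.2⟩
    set η := (x₀ ^ 2 + F x₀ ^ 2) / 2 with hη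
    have hη0 : 0 < η := by have := hx₀.1; positivity
    have hcos : ∀ x ∈ Ioc 0 x₀, |cos (F x) - cos x| ≤ η := fun x hx => by
      refine (abs_cos_sub_cos_le_half_sq_add_sq _ _).trans ?_
      have h1 := pow_le_pow_left₀ hx.1.le hx.2 2
      have h2 := pow_le_pow_left₀ (hF0 x (hsub x hx)).le (hFmono (hsub x hx) hx₀ hx.2) 2
      linarith
    have hscale : ∀ x ∈ Ioc 0 x₀, ∀ D w : ℝ, 0 < w → w < 1 - 4 * η →
        (1 - w) / 2 - η * w ≤ sin x * D → η < x * D := fun x hx D w hw hw1 hD => by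
      have h1 : η < sin x * D := by nlinarith
      have hD0 : 0 < D := pos_of_mul_pos_right (hη0.trans h1) (hs0 x (hsub x hx)).le
      exact h1.trans_le (mul_le_mul_of_nonneg_right (sin_le hx.1.le) hD0.le)
    have hlo : 1 - 4 * η ≤ sin x₀ * deriv F x₀ / sin (F x₀) := by
      refine one_sub_le_of_deriv_lower_bound (V := fun x => sin x * deriv F x / sin (F x)) hx₀.1 hη0
        (fun x hx => hv x (hsub x hx)) (fun x hx => hv0 x (hsub x hx)) fun x hx hlt => ?_
      have hxδ := hsub x hx
      have hs := hs0 x hxδ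
      refine hscale x hx _ _ (hv0 x hxδ) hlt ?_
      refine riccati_lower_bound (A := sin x ^ 2) (B := κ ^ 2 * sin (F x) ^ 2)
        (α := sin x ^ 2 + 2 * (κ ^ 2 * sin (F x) ^ 2))
        (β := 2 * sin x ^ 2 + κ ^ 2 * sin (F x) ^ 2) (by positivity) (by positivity) (hC x hxδ)
        (hcos x hx) (hv0 x hxδ) (hlt.trans (by linarith)) (by positivity) (by nlinarith) ?_
      linear_combination hric x hxδ
    have hhi : 1 - 4 * η ≤ (sin x₀ * deriv F x₀ / sin (F x₀))⁻¹ := by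
      refine one_sub_le_of_deriv_lower_bound (V := fun x => (sin x * deriv F x / sin (F x))⁻¹)
        hx₀.1 hη0 (fun x hx => (hv x (hsub x hx)).inv (hv0 x (hsub x hx)).ne')
        (fun x hx => inv_pos.2 (hv0 x (hsub x hx))) fun x hx hlt => ?_
      have hxδ := hsub x hx
      have hs := hs0 x hxδ
      have hw := hv0 x hxδ
      refine hscale x hx _ _ (inv_pos.2 hw) hlt ?_
      refine riccati_lower_bound (A := sin x ^ 2) (B := κ ^ 2 * sin (F x) ^ 2)
        (e := cos x - cos (F x)) (α := 2 * sin x ^ 2 + κ ^ 2 * sin (F x) ^ 2)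
        (β := sin x ^ 2 + 2 * (κ ^ 2 * sin (F x) ^ 2)) (by positivity) (by positivity) (hC x hxδ)
        (abs_sub_comm (cos x) _ ▸ hcos x hx) (inv_pos.2 hw) (hlt.trans (by linarith))
        (by positivity) (by nlinarith [mul_nonneg (sq_nonneg κ) (sq_nonneg (sin (F x)))]) ?_
      have h := hric x hxδ
      generalize sin x * deriv F x / sin (F x) = w at h hw ⊢
      field_simp
      linear_combination -h
    rw [inv_div] at hhi
    exact abs_mul_sub_le_of_abs_sin hx₀.1 (hx₀.2.le.trans hδ10) (hF0 x₀ hx₀) (hFsmall x₀ hx₀).le hη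
      hlo hhi (hp0 x₀ hx₀)
  obtain ⟨a, C, hC0, δ', hδ', ha⟩ := exists_abs_div_sub_le_of_log_slope hδ0 (by linarith)
    (by norm_num : (0:ℝ) < 20) hFd hF0
    (fun x hx => by nlinarith [hx.1, hx.2, hF0 x hx, hFsmall x hx]) hslope
  refine ⟨a, ?_, C, hC0, δ', hδ', fun x hx => ?_⟩
  · have hz : Tendsto (fun x : ℝ => C * x ^ 2) (𝓝[>] 0) (𝓝 0) := by
      have : Continuous fun x : ℝ => C * x ^ 2 := by fun_prop
      simpa using (this.tendsto 0).mono_left nhdsWithin_le_nhds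
    rw [tendsto_iff_dist_tendsto_zero]
    refine squeeze_zero' (Eventually.of_forall fun _ => dist_nonneg) ?_ hz
    filter_upwards [Ioo_mem_nhdsGT hδ'] with x hx
    exact ha x hx
  · have hx0 : 0 < x := hx.1
    have heq : F x - a * x = (F x / x - a) * x := by field_simp
    rw [heq, abs_mul, abs_of_pos hx0]
    calc |F x / x - a| * x ≤ C * x ^ 2 * x := mul_le_mul_of_nonneg_right (ha x hx) hx0.le
      _ = C * x ^ 3 := by ring
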